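/- Let λ ∈ (0,1) and let Γ ≥ 1 be an integer. Then the mean of the distribution with cumulative distribution function F is ∑_{x=0}^{∞} (1 − F(x)) = (Γ + 1)/2 + (1 − λ)/λ. -/

import Mathlib

/-- The stationary AoI cumulative distribution function of Theorem 4 of the
paper: `F(0) = 0`, `F(x) = (x − ((1−λ)/λ)(1 − (1−λ)^x))/Γ` for `1 ≤ x ≤ Γ`,
and `F(x) = 1 − (1−λ)^{x−Γ+1}(1 − (1−λ)^Γ)/(λΓ)` for `x ≥ Γ+1`. -/
noncomputable def Fcdf (lam : ℝ) (Γ : ℕ) (x : ℕ) : ℝ :=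
  if x = 0 then 0
  else if x ≤ Γ then ((x : ℝ) - ((1 - lam) / lam) * (1 - (1 - lam) ^ x)) / (Γ : ℝ)
  else 1 - (1 - lam) ^ (x - Γ + 1) * (1 - (1 - lam) ^ Γ) / (lam * (Γ : ℝ))

theorem Fcdf_of_le (lam : ℝ) {Γ x : ℕ} (hx : x ≤ Γ) :
    Fcdf lam Γ x = ((x : ℝ) - ((1 - lam) / lam) * (1 - (1 - lam) ^ x)) / (Γ : ℝ) := by
  rcases eq_or_ne x 0 with rfl | h0
  · simp [Fcdf]
  · simp [Fcdf, h0, hx]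

theorem one_sub_Fcdf_add (lam : ℝ) (Γ k : ℕ) :
    1 - Fcdf lam Γ (k + (Γ + 1)) =
      (1 - lam) ^ 2 * (1 - (1 - lam) ^ Γ) / (lam * Γ) * (1 - lam) ^ k := by
  have h : k + (Γ + 1) - Γ + 1 = k + 2 := by omega
  rw [Fcdf, if_neg (by omega), if_neg (by omega), h]
  ring

theorem sum_range_one_sub_Fcdf {lam : ℝ} (hlam : lam ≠ 0) {Γ : ℕ} (hΓ : Γ ≠ 0) :
    ∑ x ∈ Finset.range (Γ + 1), (1 - Fcdf lam Γ x) =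
      ((Γ : ℝ) + 1) / 2 +
        (1 - lam) / lam * (Γ + 1 - (1 - (1 - lam) ^ (Γ + 1)) / lam) / Γ := by
  have hΓ' : (Γ : ℝ) ≠ 0 := Nat.cast_ne_zero.mpr hΓ
  have closed_form (n : ℕ) :
      ∑ x ∈ Finset.range n,
        (1 - ((x : ℝ) - ((1 - lam) / lam) * (1 - (1 - lam) ^ x)) / (Γ : ℝ)) =
      n - n * (n - 1) / 2 / Γ +
        (1 - lam) / lam * (n - (1 - (1 - lam) ^ n) / lam) / Γ := by
    induction n with
    | zero => simp
    | succ n ih =>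
      rw [Finset.sum_range_succ, ih]
      push_cast
      field_simp
      ring
  rw [Finset.sum_congr rfl fun x hx => congrArg (1 - ·)
    (Fcdf_of_le lam (Nat.lt_succ_iff.mp (Finset.mem_range.mp hx))), closed_form]
  push_cast
  field_simp
  ring

theorem hasSum_one_sub_Fcdf {lam : ℝ} (hlam : lam ∈ Set.Ioo (0 : ℝ) 1) {Γ : ℕ} (hΓ : Γ ≠ 0) :
    HasSum (fun x : ℕ => 1 - Fcdf lam Γ x) (((Γ : ℝ) + 1) / 2 + (1 - lam) / lam) := by
  have hl : lam ≠ 0 := hlam.1.ne'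
  have hΓ' : (Γ : ℝ) ≠ 0 := Nat.cast_ne_zero.mpr hΓ
  have geom := (hasSum_geometric_of_lt_one (sub_nonneg.mpr hlam.2.le)
    (sub_lt_self 1 hlam.1)).mul_left ((1 - lam) ^ 2 * (1 - (1 - lam) ^ Γ) / (lam * Γ))
  simp_rw [← one_sub_Fcdf_add] at geom
  have total := (hasSum_nat_add_iff (f := fun x : ℕ => 1 - Fcdf lam Γ x) (Γ + 1)).mp geom
  rw [sum_range_one_sub_Fcdf hl hΓ, sub_sub_cancel] at total
  refine (congrArg (HasSum _ · _) ?_).mp total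
  field_simp
  ring

/-- The mean of the stationary AoI distribution:
`∑_{x≥0} (1 − F(x)) = (Γ+1)/2 + (1−λ)/λ`. -/
theorem stmt_14 (lam : ℝ) (hlam : lam ∈ Set.Ioo (0 : ℝ) 1)
    (Γ : ℕ) (hΓ : 1 ≤ Γ) :
    ∑' x : ℕ, (1 - Fcdf lam Γ x) = ((Γ : ℝ) + 1) / 2 + (1 - lam) / lam := by
  exact (hasSum_one_sub_Fcdf hlam (Nat.one_le_iff_ne_zero.mp hΓ)).tsum_eq
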